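/- Theorem 2, part 1 (tensorization of the second singular value for the MAC with common source): Let k ≥ 1, let X₁,…,X_k and Y be nonempty finite sets, let B_i be a real matrix indexed by Y × X_i for each i, let w₀ : Y → ℝ be a unit vector, and let v_i : X_i → ℝ be unit vectors satisfying B_i·v_i = w₀ and B_iᵀ·w₀ = v_i for every i. Let B₀ = [B₁ … B_k] be the block matrix indexed by Y × (Σ_i X_i) with B₀(y,(i,x)) = B_i(y,x), and let v̄ : (Σ_i X_i) → ℝ be v̄(i,x) = v_i(x). Assume the second singular value of B₀ is at most 1, i.e. ‖B₀·ψ‖ ≤ ‖ψ‖ for every ψ with ⟨ψ, v̄⟩ = 0. For n ≥ 1 let B_{0,n} = [B₁^(n) … B_k^(n)] be the block matrix indexed by (Fin n → Y) × (Σ_i (Fin n → X_i)) with B_{0,n}(r,(i,c)) = ∏_j B_i(r(j),c(j)), and let v̄_n(i,c) = ∏_j v_i(c(j)). Then for every n ≥ 1 and every ψ with ‖ψ‖ = 1 and ⟨ψ, v̄_n⟩ = 0 there exists φ with ‖φ‖ = 1 and ⟨φ, v̄⟩ = 0 such that ‖B_{0,n}·ψ‖ ≤ ‖B₀·φ‖;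 that is, the second largest singular value of B_{0,n} equals that of B₀. -/

import Mathlib

/-- The linear map with matrix `C` does not increase the Euclidean norm. -/
def IsMatrixContraction {Z U : Type*} [Fintype Z] [Fintype U] (C : Matrix Z U ℝ) : Prop :=
  ∀ f : U → ℝ, ∑ z, (∑ u, C z u * f u) ^ 2 ≤ ∑ u, f u ^ 2

/-- The block matrix `[C₁ … C_k]`, restricted to the orthogonal complement of the concatenation of
the vectors `a i`, has squared Euclidean operator norm at most `s`. -/
def BlockSqNormLE {ι Z : Type*} [Fintype ι] [Fintype Z] {U : ι → Type*} [∀ i, Fintype (U i)]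
    (C : ∀ i, Matrix Z (U i) ℝ) (a : ∀ i, U i → ℝ) (s : ℝ) : Prop :=
  ∀ φ : ∀ i, U i → ℝ, ∑ i, ∑ u, φ i u * a i u = 0 →
    ∑ z, (∑ i, ∑ u, C i z u * φ i u) ^ 2 ≤ s * ∑ i, ∑ u, φ i u ^ 2

lemma sum_sq_unit_mul_add {Y : Type*} [Fintype Y] {w g : Y → ℝ} (c : ℝ)
    (hw : ∑ y, w y ^ 2 = 1) (hg : ∑ y, w y * g y = 0) :
    ∑ y, (w y * c + g y) ^ 2 = c ^ 2 + ∑ y, g y ^ 2 := by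
  have h : ∀ y, (w y * c + g y) ^ 2 = c ^ 2 * w y ^ 2 + 2 * c * (w y * g y) + g y ^ 2 := by
    intro y; ring
  simp only [h, Finset.sum_add_distrib, ← Finset.mul_sum, hw, hg]
  ring

lemma sum_sq_eq_component_add {X : Type*} [Fintype X] {v : X → ℝ} (f : X → ℝ)
    (hv : ∑ x, v x ^ 2 = 1) :
    ∑ x, f x ^ 2 = (∑ x, v x * f x) ^ 2 + ∑ x, (f x - v x * ∑ x', v x' * f x') ^ 2 := by
  rw [← sum_sq_unit_mul_add (∑ x, v x * f x) hv]
  · simp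
  · simp only [mul_sub, Finset.sum_sub_distrib, ← mul_assoc, ← Finset.sum_mul, ← pow_two, hv]
    ring

lemma sum_mul_sub_component {X : Type*} [Fintype X] {v : X → ℝ} (f : X → ℝ)
    (hv : ∑ x, v x ^ 2 = 1) :
    ∑ x, v x * (f x - v x * ∑ x', v x' * f x') = 0 := by
  simp only [mul_sub, Finset.sum_sub_distrib, ← mul_assoc, ← Finset.sum_mul, ← pow_two, hv]
  ring

lemma sum_mul_block_eq_zero {ι Y : Type*} [Fintype ι] [Fintype Y] {X : ι → Type*}
    [∀ i, Fintype (X i)] {B : ∀ i, Matrix Y (X i) ℝ} {w : Y → ℝ} {v : ∀ i, X i → ℝ}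
    (hBw : ∀ i x, ∑ y, B i y x * w y = v i x) {d : ∀ i, X i → ℝ}
    (hd : ∑ i, ∑ x, d i x * v i x = 0) :
    ∑ y, w y * ∑ i, ∑ x, B i y x * d i x = 0 := by
  rw [← hd]
  simp only [Finset.mul_sum]
  rw [Finset.sum_comm]
  refine Finset.sum_congr rfl fun i _ => ?_
  rw [Finset.sum_comm]
  refine Finset.sum_congr rfl fun x _ => ?_
  rw [← hBw, Finset.mul_sum]
  exact Finset.sum_congr rfl fun y _ => by ring

/-- A block matrix sending each unit vector `v i` to the same unit vector `w` and back has
contractive blocks as soon as it is contractive on the complement of the concatenation of `v`. -/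
lemma BlockSqNormLE.isMatrixContraction {ι Y : Type*} [Fintype ι] [Fintype Y]
    {X : ι → Type*} [∀ i, Fintype (X i)] {B : ∀ i, Matrix Y (X i) ℝ} {w : Y → ℝ}
    {v : ∀ i, X i → ℝ} (hw : ∑ y, w y ^ 2 = 1) (hv : ∀ i, ∑ x, v i x ^ 2 = 1)
    (hBv : ∀ i y, ∑ x, B i y x * v i x = w y) (hBw : ∀ i x, ∑ y, B i y x * w y = v i x)
    (hB : BlockSqNormLE B v 1) (i : ι) : IsMatrixContraction (B i) := by
  classical
  intro f
  set c := ∑ x, v i x * f x with hc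
  set b : X i → ℝ := fun x => f x - v i x * c with hb
  have hperp : ∑ j, ∑ x, (Pi.single i b : ∀ j, X j → ℝ) j x * v j x = 0 := by
    rw [Finset.sum_eq_single i]
    · simpa [mul_comm] using sum_mul_sub_component f (hv i)
    · intro j _ hj; simp [hj]
    · simp
  have hout : ∀ y, ∑ j, ∑ x, B j y x * (Pi.single i b : ∀ j, X j → ℝ) j x =
      ∑ x, B i y x * b x := by
    intro y
    rw [Finset.sum_eq_single i]
    · simp
    · intro j _ hj; simp [hj]
    · simp
  have hnorm : ∑ j, ∑ x, (Pi.single i b : ∀ j, X j → ℝ) j x ^ 2 = ∑ x, b x ^ 2 := by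
    rw [Finset.sum_eq_single i]
    · simp
    · intro j _ hj; simp [hj]
    · simp
  have hdecomp : ∀ y, ∑ x, B i y x * f x = w y * c + ∑ x, B i y x * b x := by
    intro y
    simp only [hb, mul_sub, Finset.sum_sub_distrib, ← mul_assoc, ← Finset.sum_mul, hBv]
    ring
  have hort := sum_mul_block_eq_zero hBw hperp
  have hle := hB _ hperp
  simp only [hout, hnorm, one_mul] at hort hle
  simp only [hdecomp]
  rw [sum_sq_unit_mul_add c hw hort, sum_sq_eq_component_add f (hv i)]
  gcongr

lemma IsMatrixContraction.sum_sum_sq_le {Y Z X U : Type*} [Fintype Y] [Fintype Z] [Fintype X]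
    [Fintype U] {A : Matrix Y X ℝ} {C : Matrix Z U ℝ} (hA : IsMatrixContraction A)
    (hC : IsMatrixContraction C) (f : X → U → ℝ) :
    ∑ y, ∑ z, (∑ x, ∑ u, A y x * C z u * f x u) ^ 2 ≤ ∑ x, ∑ u, f x u ^ 2 := by
  simp only [mul_assoc, ← Finset.mul_sum]
  rw [Finset.sum_comm]
  calc _ ≤ ∑ z, ∑ x, (∑ u, C z u * f x u) ^ 2 := Finset.sum_le_sum fun z _ => hA _
    _ = ∑ x, ∑ z, (∑ u, C z u * f x u) ^ 2 := Finset.sum_comm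
    _ ≤ _ := Finset.sum_le_sum fun x _ => hC _

/-- The bound of `BlockSqNormLE` passes to the blockwise Kronecker product with contractions. -/
lemma BlockSqNormLE.sum_sum_sq_le {ι Y Z : Type*} [Fintype ι] [Fintype Y] [Fintype Z]
    {X U : ι → Type*} [∀ i, Fintype (X i)] [∀ i, Fintype (U i)]
    {B : ∀ i, Matrix Y (X i) ℝ} {C : ∀ i, Matrix Z (U i) ℝ} {w : Y → ℝ}
    {v : ∀ i, X i → ℝ} {a : ∀ i, U i → ℝ} {s : ℝ} (hs : 0 ≤ s)
    (hw : ∑ y, w y ^ 2 = 1) (hv : ∀ i, ∑ x, v i x ^ 2 = 1)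
    (hBv : ∀ i y, ∑ x, B i y x * v i x = w y) (hBw : ∀ i x, ∑ y, B i y x * w y = v i x)
    (hB : BlockSqNormLE B v s) (hC : ∀ i, IsMatrixContraction (C i))
    (hCs : BlockSqNormLE C a s) (f : ∀ i, X i → U i → ℝ)
    (hf : ∑ i, ∑ x, ∑ u, f i x u * (v i x * a i u) = 0) :
    ∑ y, ∑ z, (∑ i, ∑ x, ∑ u, B i y x * C i z u * f i x u) ^ 2 ≤
      s * ∑ i, ∑ x, ∑ u, f i x u ^ 2 := by
  set p : ∀ i, U i → ℝ := fun i u => ∑ x, v i x * f i x u with hp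
  set b : ∀ i, X i → U i → ℝ := fun i x u => f i x u - v i x * p i u with hb
  set d : ∀ i, Z → X i → ℝ := fun i z x => ∑ u, C i z u * b i x u with hd
  have hp0 : ∑ i, ∑ u, p i u * a i u = 0 := by
    rw [← hf]
    refine Finset.sum_congr rfl fun i _ => ?_
    rw [Finset.sum_comm]
    refine Finset.sum_congr rfl fun u _ => ?_
    rw [hp, Finset.sum_mul]
    exact Finset.sum_congr rfl fun x _ => by ring
  have hd0 : ∀ z, ∑ i, ∑ x, d i z x * v i x = 0 := by
    intro z
    refine Finset.sum_eq_zero fun i _ => ?_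
    simp only [hd, Finset.sum_mul]
    rw [Finset.sum_comm]
    refine Finset.sum_eq_zero fun u _ => ?_
    have := sum_mul_sub_component (fun x => f i x u) (hv i)
    calc _ = C i z u * ∑ x, v i x * b i x u := by
          rw [Finset.mul_sum]
          exact Finset.sum_congr rfl fun x _ => by ring
      _ = 0 := by rw [hb, hp, this, mul_zero]
  have hdecomp : ∀ y z, ∑ i, ∑ x, ∑ u, B i y x * C i z u * f i x u =
      w y * (∑ i, ∑ u, C i z u * p i u) + ∑ i, ∑ x, B i y x * d i z x := by
    intro y z
    rw [Finset.mul_sum, ← Finset.sum_add_distrib]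
    refine Finset.sum_congr rfl fun i _ => ?_
    rw [← hBv i y, Finset.sum_mul, ← Finset.sum_add_distrib]
    refine Finset.sum_congr rfl fun x _ => ?_
    rw [hd, Finset.mul_sum, Finset.mul_sum, ← Finset.sum_add_distrib]
    refine Finset.sum_congr rfl fun u _ => ?_
    simp only [hb]
    ring
  have hnorm : ∑ i, ∑ x, ∑ u, f i x u ^ 2 =
      ∑ i, ∑ u, p i u ^ 2 + ∑ i, ∑ x, ∑ u, b i x u ^ 2 := by
    rw [← Finset.sum_add_distrib]
    refine Finset.sum_congr rfl fun i _ => ?_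
    rw [Finset.sum_comm, Finset.sum_comm (f := fun x u => b i x u ^ 2),
      ← Finset.sum_add_distrib]
    exact Finset.sum_congr rfl fun u _ => sum_sq_eq_component_add (fun x => f i x u) (hv i)
  have hd_le : ∑ z, ∑ i, ∑ x, d i z x ^ 2 ≤ ∑ i, ∑ x, ∑ u, b i x u ^ 2 := by
    rw [Finset.sum_comm]
    refine Finset.sum_le_sum fun i _ => ?_
    rw [Finset.sum_comm]
    exact Finset.sum_le_sum fun x _ => hC i _
  simp only [hdecomp]
  rw [Finset.sum_comm, hnorm, mul_add]
  calc _ = ∑ z, ((∑ i, ∑ u, C i z u * p i u) ^ 2 +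
          ∑ y, (∑ i, ∑ x, B i y x * d i z x) ^ 2) :=
        Finset.sum_congr rfl fun z _ =>
          sum_sq_unit_mul_add _ hw (sum_mul_block_eq_zero hBw (hd0 z))
    _ ≤ ∑ z, ((∑ i, ∑ u, C i z u * p i u) ^ 2 + s * ∑ i, ∑ x, d i z x ^ 2) := by
        gcongr with z
        exact hB (fun i => d i z) (hd0 z)
    _ = ∑ z, (∑ i, ∑ u, C i z u * p i u) ^ 2 + s * ∑ z, ∑ i, ∑ x, d i z x ^ 2 := by
        rw [Finset.sum_add_distrib, Finset.mul_sum]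
    _ ≤ _ := by
        gcongr
        exact hCs p hp0

lemma sum_fin_succ_pi {X : Type*} [Fintype X] (n : ℕ) (F : (Fin (n + 1) → X) → ℝ) :
    ∑ c, F c = ∑ x, ∑ c : Fin n → X, F (Fin.cons x c) := by
  rw [← (Fin.consEquiv fun _ : Fin (n + 1) => X).sum_comp, Fintype.sum_prod_type]
  rfl

/-- The `n`-fold Kronecker power of a matrix. -/
def kroneckerPow {Y X : Type*} (B : Matrix Y X ℝ) (n : ℕ) :
    Matrix (Fin n → Y) (Fin n → X) ℝ :=
  fun r c => ∏ j, B (r j) (c j)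

lemma IsMatrixContraction.kroneckerPower {Y X : Type*} [Fintype Y] [Fintype X]
    {B : Matrix Y X ℝ} (hB : IsMatrixContraction B) (n : ℕ) :
    IsMatrixContraction (kroneckerPow B n) := by
  induction n with
  | zero => intro f; simp [kroneckerPow]
  | succ n ih =>
    intro f
    simp only [sum_fin_succ_pi]
    simpa [kroneckerPow, Fin.prod_univ_succ] using
      hB.sum_sum_sq_le ih fun x c => f (Fin.cons x c)

lemma BlockSqNormLE.kroneckerPower {ι Y : Type*} [Fintype ι] [Fintype Y]
    {X : ι → Type*} [∀ i, Fintype (X i)] {B : ∀ i, Matrix Y (X i) ℝ} {w : Y → ℝ}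
    {v : ∀ i, X i → ℝ} {s : ℝ} (hs : 0 ≤ s)
    (hw : ∑ y, w y ^ 2 = 1) (hv : ∀ i, ∑ x, v i x ^ 2 = 1)
    (hBv : ∀ i y, ∑ x, B i y x * v i x = w y) (hBw : ∀ i x, ∑ y, B i y x * w y = v i x)
    (hB1 : BlockSqNormLE B v 1) (hB : BlockSqNormLE B v s) (n : ℕ) :
    BlockSqNormLE (fun i => kroneckerPow (B i) n) (fun i c => ∏ j, v i (c j)) s := by
  induction n with
  | zero =>
    intro φ hφ
    have hpos : 0 ≤ s * ∑ i, φ i default ^ 2 := by positivity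
    simp only [Finset.univ_unique, Finset.sum_singleton, Finset.univ_eq_empty,
      Finset.prod_empty, mul_one, kroneckerPow, one_mul] at hφ ⊢
    simpa [hφ] using hpos
  | succ n ih =>
    intro φ hφ
    simp only [sum_fin_succ_pi] at hφ ⊢
    have h := hB.sum_sum_sq_le hs hw hv hBv hBw
      (fun i => (hB1.isMatrixContraction hw hv hBv hBw i).kroneckerPower n) ih
      (fun i x c => φ i (Fin.cons x c))
      (by simpa [Fin.prod_univ_succ] using hφ)
    simpa [kroneckerPow, Fin.prod_univ_succ] using h

/-- A matrix attains its operator norm on the unit sphere of a hyperplane. -/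
lemma exists_max_sum_sq_of_perp {P Y : Type*} [Fintype P] [Fintype Y] (M : Matrix Y P ℝ)
    (a : P → ℝ) (hP : 1 < Fintype.card P) :
    ∃ φ : P → ℝ, ∑ p, φ p ^ 2 = 1 ∧ ∑ p, φ p * a p = 0 ∧
      ∀ f : P → ℝ, ∑ p, f p * a p = 0 →
        ∑ y, (∑ p, M y p * f p) ^ 2 ≤ (∑ y, (∑ p, M y p * φ p) ^ 2) * ∑ p, f p ^ 2 := by
  have hscale : ∀ f : P → ℝ, f ≠ 0 → ∑ p, f p * a p = 0 →
      0 < ∑ p, f p ^ 2 ∧ ∃ g : P → ℝ, ∑ p, g p ^ 2 = 1 ∧ ∑ p, g p * a p = 0 ∧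
        ∑ y, (∑ p, M y p * f p) ^ 2 =
          (∑ y, (∑ p, M y p * g p) ^ 2) * ∑ p, f p ^ 2 := by
    intro f hf hfa
    obtain ⟨p, hp⟩ := Function.ne_iff.mp hf
    have hN : 0 < ∑ p, f p ^ 2 :=
      Finset.sum_pos' (fun _ _ => sq_nonneg _) ⟨p, Finset.mem_univ p, sq_pos_of_ne_zero hp⟩
    obtain ⟨t, ht⟩ : ∃ t : ℝ, t ^ 2 = ∑ p, f p ^ 2 := ⟨_, Real.sq_sqrt hN.le⟩
    have ht0 : t ≠ 0 := by
      rintro rfl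
      simp at ht
      linarith
    refine ⟨hN, fun p => t⁻¹ * f p, ?_, ?_, ?_⟩
    · simp only [mul_pow, ← Finset.mul_sum, ← ht]
      field_simp
    · simp only [mul_assoc, ← Finset.mul_sum, hfa, mul_zero]
    · simp only [mul_left_comm _ t⁻¹, ← Finset.mul_sum, mul_pow, ← ht]
      field_simp
  have hcompact : IsCompact {φ : P → ℝ | ∑ p, φ p ^ 2 = 1 ∧ ∑ p, φ p * a p = 0} := by
    refine isCompact_Icc.of_isClosed_subset (s := Set.Icc (-1) 1) ?_ ?_
    · exact (isClosed_eq (by fun_prop) continuous_const).inter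
        (isClosed_eq (by fun_prop) continuous_const)
    · rintro φ ⟨h1, -⟩
      have h : ∀ p, |φ p| ≤ 1 := fun p => by
        rw [← sq_le_one_iff_abs_le_one, ← h1]
        exact Finset.single_le_sum (f := fun p => φ p ^ 2) (fun _ _ => sq_nonneg _)
          (Finset.mem_univ p)
      exact ⟨fun p => (abs_le.mp (h p)).1, fun p => (abs_le.mp (h p)).2⟩
  have hnonempty : {φ : P → ℝ | ∑ p, φ p ^ 2 = 1 ∧ ∑ p, φ p * a p = 0}.Nonempty := by
    have hker := LinearMap.ker_ne_bot_of_finrank_lt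
      (f := (Fintype.linearCombination ℝ a : (P → ℝ) →ₗ[ℝ] ℝ)) (by simpa using hP)
    obtain ⟨f, hf, hf0⟩ := Submodule.exists_mem_ne_zero_of_ne_bot hker
    rw [LinearMap.mem_ker, Fintype.linearCombination_apply] at hf
    obtain ⟨-, g, hg1, hg2, -⟩ := hscale f hf0 (by simpa using hf)
    exact ⟨g, hg1, hg2⟩
  obtain ⟨φ, ⟨hφ1, hφ2⟩, hmax⟩ := hcompact.exists_isMaxOn hnonempty
    (f := fun φ : P → ℝ => ∑ y, (∑ p, M y p * φ p) ^ 2) (by fun_prop)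
  refine ⟨φ, hφ1, hφ2, fun f hf => ?_⟩
  by_cases hf0 : f = 0
  · simp [hf0]
  · obtain ⟨hN, g, hg1, hg2, hg⟩ := hscale f hf0 hf
    rw [hg]
    exact mul_le_mul_of_nonneg_right (hmax (show g ∈ _ from ⟨hg1, hg2⟩)) hN.le

/-- A unit vector on `n` letters orthogonal to the product vectors needs two input letters. -/
lemma one_lt_card_sigma_of_perp {ι : Type*} [Fintype ι] {X : ι → Type*} [∀ i, Fintype (X i)]
    {v : ∀ i, X i → ℝ} (hv : ∀ i, ∑ x, v i x ^ 2 = 1) [∀ i, Nonempty (X i)] {n : ℕ}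
    {ψ : (Σ i, Fin n → X i) → ℝ} (hψ1 : ∑ p : Σ i, Fin n → X i, ψ p ^ 2 = 1)
    (hψ2 : ∑ p : Σ i, Fin n → X i, ψ p * ∏ j, v p.1 (p.2 j) = 0) :
    1 < Fintype.card (Σ i, X i) := by
  by_contra hcard
  rw [not_lt, Fintype.card_le_one_iff_subsingleton] at hcard
  have hX : ∀ i, Subsingleton (X i) := fun i =>
    (sigma_mk_injective (i := i)).subsingleton
  have hι : Subsingleton ι := ⟨fun i j => congrArg Sigma.fst
    (Subsingleton.elim (⟨i, Classical.arbitrary _⟩ : Σ i, X i) ⟨j, Classical.arbitrary _⟩)⟩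
  have hsub : Subsingleton (Σ i, Fin n → X i) := by
    refine ⟨?_⟩
    rintro ⟨i, c⟩ ⟨j, d⟩
    obtain rfl := Subsingleton.elim i j
    rw [Subsingleton.elim c d]
  have hv0 : ∀ i x, v i x ≠ 0 := by
    intro i x h
    have h1 := hv i
    rw [Fintype.sum_subsingleton _ x, h] at h1
    norm_num at h1
  rcases isEmpty_or_nonempty (Σ i, Fin n → X i) with hE | ⟨⟨q⟩⟩
  · simp at hψ1
  · rw [Fintype.sum_subsingleton _ q] at hψ1 hψ2
    rcases mul_eq_zero.mp hψ2 with h | h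
    · rw [h] at hψ1
      norm_num at hψ1
    · exact Finset.prod_ne_zero_iff.mpr (fun j _ => hv0 _ _) h

/-- Theorem 2, part 1 (tensorization of the second singular value for the MAC
with common source): under the stated hypotheses on the block matrix
`B₀ = [B₁ … B_k]` and the vector `v̄` (the concatenation of the `v_i`),
for every `n ≥ 1` and every unit vector `ψ` (on `n` letters) orthogonal to
`v̄_n`, there is a single-letter unit vector `φ` orthogonal to `v̄` with
`‖B_{0,n}ψ‖ ≤ ‖B₀φ‖`; i.e. the second largest singular value of `B_{0,n}`
equals that of `B₀`. -/
theorem mac_second_singular_value_tensorizes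
    (k : ℕ) (hk : 1 ≤ k) {Y : Type*} [Fintype Y] [Nonempty Y]
    (X : Fin k → Type*) [∀ i, Fintype (X i)] [∀ i, Nonempty (X i)]
    (B : ∀ i, Matrix Y (X i) ℝ)
    (w₀ : Y → ℝ) (hw₀ : ∑ y, w₀ y ^ 2 = 1)
    (v : ∀ i, X i → ℝ) (hv : ∀ i, ∑ x, v i x ^ 2 = 1)
    (hBv : ∀ i, (B i).mulVec (v i) = w₀)
    (hBw : ∀ i, (B i).transpose.mulVec w₀ = v i)
    (hsv : ∀ ψ : (Σ i, X i) → ℝ, (∑ p : Σ i, X i, ψ p * v p.1 p.2) = 0 →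
        ∑ y, (∑ p : Σ i, X i, B p.1 y p.2 * ψ p) ^ 2 ≤ ∑ p : Σ i, X i, ψ p ^ 2)
    (n : ℕ) (hn : 1 ≤ n)
    (ψ : (Σ i, Fin n → X i) → ℝ)
    (hψ1 : ∑ p : Σ i, Fin n → X i, ψ p ^ 2 = 1)
    (hψ2 : ∑ p : Σ i, Fin n → X i, ψ p * ∏ j, v p.1 (p.2 j) = 0) :
    ∃ φ : (Σ i, X i) → ℝ,
      (∑ p : Σ i, X i, φ p ^ 2 = 1) ∧
      (∑ p : Σ i, X i, φ p * v p.1 p.2 = 0) ∧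
      ∑ r : Fin n → Y,
          (∑ p : Σ i, Fin n → X i, (∏ j, B p.1 (r j) (p.2 j)) * ψ p) ^ 2
        ≤ ∑ y, (∑ p : Σ i, X i, B p.1 y p.2 * φ p) ^ 2 := by
  obtain ⟨φ, hφ1, hφ2, hmax⟩ := exists_max_sum_sq_of_perp
    (fun y (p : Σ i, X i) => B p.1 y p.2) (fun p => v p.1 p.2)
    (one_lt_card_sigma_of_perp hv hψ1 hψ2)
  refine ⟨φ, hφ1, hφ2, ?_⟩
  have hB1 : BlockSqNormLE B v 1 := fun f hf => by
    simpa [Fintype.sum_sigma] using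
      hsv (fun p => f p.1 p.2) (by simpa [Fintype.sum_sigma] using hf)
  have hB : BlockSqNormLE B v (∑ y, (∑ p : Σ i, X i, B p.1 y p.2 * φ p) ^ 2) := fun f hf => by
    have h := hmax (fun p => f p.1 p.2) (by simpa [Fintype.sum_sigma] using hf)
    simpa [Fintype.sum_sigma] using h
  have h := hB1.kroneckerPower (Finset.sum_nonneg fun _ _ => sq_nonneg _) hw₀ hv
    (fun i y => congrFun (hBv i) y) (fun i x => congrFun (hBw i) x) hB n
    (fun i c => ψ ⟨i, c⟩) (by simpa [Fintype.sum_sigma] using hψ2)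
  rw [Fintype.sum_sigma] at hψ1
  rw [hψ1, mul_one] at h
  simpa only [Fintype.sum_sigma, kroneckerPow] using h
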